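/- arXiv:1704.05998 — 2 statements merged into one kernel-verified Lean document; each statement's English description precedes it below -/
import Mathlib

section
/- Let n ≥ 1, let R be an n×n real upper triangular matrix with positive diagonal entries r_11,…,r_nn, let σ > 0, and let B = {x ∈ ℤⁿ : ℓ ≤ x ≤ u} with ℓ, u ∈ ℤⁿ and ℓ_i < u_i for all i. Fix a deterministic x̂ ∈ B, let ṽ ~ N(0, σ²Iₙ), and set ỹ = R x̂ + ṽ. Define the box-constrained Babai detector x^BB recursively for i = n, n−1, …, 1 by c_i = (ỹ_i − ∑_{j=i+1}^n r_ij x_j^BB)/r_ii and x_i^BB = ℓ_i if ⌊c_i⌉ ≤ ℓ_i, x_i^BB = ⌊c_i⌉ if ℓ_i < ⌊c_i⌉ < u_i, x_i^BB = u_i if ⌊c_i⌉ ≥ u_i. Then Pr(x^BB = x̂) = ∏_{i=1}^n ω_i, where ω_i = (1/2)(1 + φ_σ(r_ii)) if x̂_i = ℓ_i or x̂_i = u_i, and ω_i = φ_σ(r_ii) if ℓ_i < x̂_i < u_i. -/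
open MeasureTheory ProbabilityTheory Matrix
open scoped ENNReal NNReal

/-- Nearest integer rounding, with ties broken toward the integer of smaller magnitude. -/
noncomputable def nround (x : ℝ) : ℤ :=
  if 0 ≤ x then ⌈x - 1 / 2⌉ else ⌊x + 1 / 2⌋

/-- Clamp the nearest integer of `c` to the interval `[a, b]`:
`a` if `⌊c⌉ ≤ a`, `b` if `⌊c⌉ ≥ b`, and `⌊c⌉` otherwise. -/
noncomputable def clampInt (a b : ℤ) (c : ℝ) : ℤ :=
  if nround c ≤ a then a
  else if b ≤ nround c then b
  else nround c

/-- The box-constrained rounding detector computed from `d`. -/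
noncomputable def roundDetector {n : ℕ} (l u : Fin n → ℤ) (d : Fin n → ℝ) : Fin n → ℤ :=
  fun i => clampInt (l i) (u i) (d i)

/-- Auxiliary recursion for the box-constrained Babai detector: `babaiAux R l u y k`
has the correct Babai values at indices `i` with `i + k ≥ n` (computed from the last
index downwards). -/
noncomputable def babaiAux {n : ℕ} (R : Matrix (Fin n) (Fin n) ℝ) (l u : Fin n → ℤ)
    (y : Fin n → ℝ) : ℕ → Fin n → ℤ
  | 0 => fun _ => 0
  | k + 1 => fun i =>
      if i.val + (k + 1) = n then
        clampInt (l i) (u i)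
          ((y i - ∑ j : Fin n, if i < j then R i j * (babaiAux R l u y k j : ℝ) else 0) / R i i)
      else babaiAux R l u y k i

/-- The box-constrained Babai detector computed from `y`, for upper triangular `R`:
for `i = n, …, 1`, `c_i = (y_i - ∑_{j>i} r_{ij} x_j^BB)/r_{ii}` and `x_i^BB` is `⌊c_i⌉`
clamped to `[l_i, u_i]`. -/
noncomputable def babaiDetector {n : ℕ} (R : Matrix (Fin n) (Fin n) ℝ) (l u : Fin n → ℤ)
    (y : Fin n → ℝ) : Fin n → ℤ :=
  babaiAux R l u y n

/-- `phi σ ζ = (2/√(2π)) ∫_0^{ζ/(2σ)} exp(-t²/2) dt`. -/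
noncomputable def phi (σ ζ : ℝ) : ℝ :=
  2 / Real.sqrt (2 * Real.pi) * ∫ t in (0:ℝ)..(ζ / (2 * σ)), Real.exp (-(t ^ 2) / 2)

theorem nround_le_of_lt {c : ℝ} {k : ℤ} (h : c < k + 1 / 2) : nround c ≤ k := by
  unfold nround
  split_ifs
  · exact Int.ceil_le.2 (by linarith)
  · exact Int.lt_add_one_iff.1 (Int.floor_lt.2 (by push_cast; linarith))

theorem le_nround_of_lt {c : ℝ} {k : ℤ} (h : k - 1 / 2 < c) : k ≤ nround c := by
  unfold nround
  split_ifs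
  · exact Int.sub_one_lt_iff.1 (Int.lt_ceil.2 (by push_cast; linarith))
  · exact Int.le_floor.2 (by linarith)

theorem le_of_nround_le {c : ℝ} {k : ℤ} (h : nround c ≤ k) : c ≤ k + 1 / 2 := by
  by_contra! hc
  have := le_nround_of_lt (c := c) (k := k + 1) (by push_cast; linarith)
  omega

theorem le_of_le_nround {c : ℝ} {k : ℤ} (h : k ≤ nround c) : k - 1 / 2 ≤ c := by
  by_contra! hc
  have := nround_le_of_lt (c := c) (k := k - 1) (by push_cast; linarith)
  omega

theorem measurable_nround : Measurable nround :=
  Measurable.ite measurableSet_Ici (Int.measurable_ceil.comp (measurable_id.sub_const _))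
    (Int.measurable_floor.comp (measurable_id.add_const _))

theorem measurable_clampInt (a b : ℤ) : Measurable (clampInt a b) :=
  (measurable_from_top (f := fun k : ℤ => if k ≤ a then a else if b ≤ k then b else k)).comp
    measurable_nround

theorem clampInt_eq_left_iff {a b : ℤ} (hab : a < b) (c : ℝ) :
    clampInt a b c = a ↔ nround c ≤ a := by
  unfold clampInt
  split_ifs <;> omega

theorem clampInt_eq_right_iff {a b : ℤ} (hab : a < b) (c : ℝ) :
    clampInt a b c = b ↔ b ≤ nround c := by
  unfold clampInt
  split_ifs <;> omega

theorem clampInt_eq_interior_iff {a b x : ℤ} (ha : a < x) (hb : x < b) (c : ℝ) :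
    clampInt a b c = x ↔ nround c = x := by
  unfold clampInt
  split_ifs <;> omega

/-- The values computed by `babaiAux` on its last `k` coordinates agree with `x` exactly when
each of these coordinates is decoded correctly given that the later ones are. -/
theorem babaiAux_eq_iff {n : ℕ} (R : Matrix (Fin n) (Fin n) ℝ) (l u : Fin n → ℤ)
    (y : Fin n → ℝ) (x : Fin n → ℤ) (k : ℕ) :
    (∀ i : Fin n, n ≤ i.val + k → babaiAux R l u y k i = x i) ↔
      ∀ i : Fin n, n ≤ i.val + k →
        clampInt (l i) (u i)
          ((y i - ∑ j : Fin n, if i < j then R i j * (x j : ℝ) else 0) / R i i) = x i := by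
  induction k with
  | zero => exact ⟨fun _ i hi => by omega, fun _ i hi => by omega⟩
  | succ k ih =>
    have hsum (h : ∀ i : Fin n, n ≤ i.val + k → babaiAux R l u y k i = x i) (i : Fin n)
        (hi : i.val + (k + 1) = n) :
        babaiAux R l u y (k + 1) i = clampInt (l i) (u i)
          ((y i - ∑ j : Fin n, if i < j then R i j * (x j : ℝ) else 0) / R i i) := by
      simp only [babaiAux, if_pos hi]
      congr 3
      refine Finset.sum_congr rfl fun j _ => ?_
      split_ifs with hij
      · rw [h j (by have := Fin.lt_def.1 hij; omega)]
      · rfl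
    have hlater (i : Fin n) (hi : n ≤ i.val + k) :
        babaiAux R l u y (k + 1) i = babaiAux R l u y k i := by
      have hik : i.val + (k + 1) ≠ n := by omega
      simp only [babaiAux, if_neg hik]
    constructor
    · intro h
      have h' : ∀ i : Fin n, n ≤ i.val + k → babaiAux R l u y k i = x i := fun i hi => by
        rw [← hlater i hi, h i (by omega)]
      intro i hi
      by_cases hik : i.val + (k + 1) = n
      · rw [← hsum h' i hik, h i hi]
      · exact ih.1 h' i (by omega)
    · intro h
      have h' := ih.2 fun i hi => h i (by omega)
      intro i hi
      by_cases hik : i.val + (k + 1) = n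
      · rw [hsum h' i hik, h i hi]
      · rw [hlater i (by omega), h' i (by omega)]

theorem babaiDetector_eq_iff {n : ℕ} (R : Matrix (Fin n) (Fin n) ℝ) (l u : Fin n → ℤ)
    (y : Fin n → ℝ) (x : Fin n → ℤ) :
    babaiDetector R l u y = x ↔ ∀ i : Fin n,
      clampInt (l i) (u i)
        ((y i - ∑ j : Fin n, if i < j then R i j * (x j : ℝ) else 0) / R i i) = x i := by
  simpa [funext_iff, babaiDetector] using babaiAux_eq_iff R l u y x n

theorem mulVec_eq_diag_add_of_upper {n : ℕ} (R : Matrix (Fin n) (Fin n) ℝ)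
    (hupper : ∀ i j : Fin n, j < i → R i j = 0) (x : Fin n → ℝ) (i : Fin n) :
    (R *ᵥ x) i = R i i * x i + ∑ j : Fin n, if i < j then R i j * x j else 0 := by
  have hdiag : R i i * x i = ∑ j : Fin n, if j = i then R i j * x j else 0 := by simp
  rw [hdiag, ← Finset.sum_add_distrib, Matrix.mulVec, dotProduct]
  refine Finset.sum_congr rfl fun j _ => ?_
  rcases lt_trichotomy j i with h | h | h
  · simp [hupper i j h, h.ne, h.not_gt]
  · simp [h]
  · simp [h, h.ne']

theorem ne_zero_of_coe_eq_sq {v : ℝ≥0} {σ : ℝ} (hv : (v : ℝ) = σ ^ 2) (hσ : 0 < σ) : v ≠ 0 :=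
  fun h => (pow_pos hσ 2).ne' (by rw [← hv, h, NNReal.coe_zero])

theorem gaussianReal_real_Ioc_neg_self {v : ℝ≥0} {σ : ℝ} (hv : (v : ℝ) = σ ^ 2) (hσ : 0 < σ)
    {r : ℝ} (hr : 0 < r) :
    (gaussianReal 0 v).real (Set.Ioc (-(r / 2)) (r / 2)) = phi σ r := by
  have hv0 := ne_zero_of_coe_eq_sq hv hσ
  set f : ℝ → ℝ := fun t => Real.exp (-(t ^ 2) / 2) with hf
  have hcont : Continuous f := by fun_prop
  have hpdf (x : ℝ) : gaussianPDFReal 0 v x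
      = (Real.sqrt (2 * Real.pi) * σ)⁻¹ * f (x / σ) := by
    rw [gaussianPDFReal, hf, hv, sub_zero, Real.sqrt_mul (by positivity), Real.sqrt_sq hσ.le]
    congr 2
    field_simp
  have hphi : phi σ r = 2 / Real.sqrt (2 * Real.pi) * ∫ t in (0 : ℝ)..(r / 2 / σ), f t := by
    rw [phi, div_div]
  have heven : ∫ t in (-(r / 2 / σ))..0, f t = ∫ t in (0 : ℝ)..(r / 2 / σ), f t := by
    have := intervalIntegral.integral_comp_neg f (a := 0) (b := r / 2 / σ)
    rw [neg_zero] at this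
    rw [← this]
    simp [hf]
  rw [measureReal_def, gaussianReal_apply_eq_integral _ hv0,
    ENNReal.toReal_ofReal (integral_nonneg fun x => gaussianPDFReal_nonneg _ _ _),
    ← intervalIntegral.integral_of_le (by linarith)]
  simp_rw [hpdf]
  rw [intervalIntegral.integral_const_mul, intervalIntegral.integral_comp_div f hσ.ne', neg_div,
    ← intervalIntegral.integral_add_adjacent_intervals (b := 0)
      (hcont.intervalIntegrable _ _) (hcont.intervalIntegrable _ _), heven, hphi,
    smul_eq_mul]
  field_simp
  ring

theorem gaussianReal_real_Iio_neg (v : ℝ≥0) (a : ℝ) :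
    (gaussianReal 0 v).real (Set.Iio (-a)) = (gaussianReal 0 v).real (Set.Ioi a) := by
  have h : (gaussianReal 0 v).map (fun x => -x) = gaussianReal 0 v := by
    simpa using gaussianReal_map_neg (μ := 0) (v := v)
  conv_lhs => rw [← h]
  rw [map_measureReal_apply measurable_neg measurableSet_Iio]
  congr 1
  ext x
  simp

theorem gaussianReal_real_Iic {v : ℝ≥0} {σ : ℝ} (hv : (v : ℝ) = σ ^ 2) (hσ : 0 < σ)
    {r : ℝ} (hr : 0 < r) :
    (gaussianReal 0 v).real (Set.Iic (r / 2)) = 1 / 2 * (1 + phi σ r) := by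
  have := nullSingletonClass_gaussianReal (μ := 0) (ne_zero_of_coe_eq_sq hv hσ)
  have hmid := gaussianReal_real_Ioc_neg_self hv hσ hr
  have hsymm := gaussianReal_real_Iio_neg v (r / 2)
  have hsplit := measureReal_union (μ := gaussianReal 0 v) (s₁ := Set.Iic (-(r / 2)))
    (s₂ := Set.Ioc (-(r / 2)) (r / 2)) (Set.Iic_disjoint_Ioc le_rfl) measurableSet_Ioc
  rw [Set.Iic_union_Ioc_eq_Iic (by linarith), hmid,
    ← measureReal_congr (Iio_ae_eq_Iic (μ := gaussianReal 0 v) (a := -(r / 2))), hsymm] at hsplit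
  have hcompl := probReal_compl_eq_one_sub (μ := gaussianReal 0 v) (s := Set.Iic (r / 2))
    measurableSet_Iic
  rw [Set.compl_Iic] at hcompl
  linarith

theorem gaussianReal_real_Ici_neg {v : ℝ≥0} {σ : ℝ} (hv : (v : ℝ) = σ ^ 2) (hσ : 0 < σ)
    {r : ℝ} (hr : 0 < r) :
    (gaussianReal 0 v).real (Set.Ici (-(r / 2)))
      = 1 / 2 * (1 + phi σ r) := by
  rw [← gaussianReal_real_Iic hv hσ hr, ← Set.compl_Iio, ← Set.compl_Ioi,
    probReal_compl_eq_one_sub measurableSet_Iio, probReal_compl_eq_one_sub measurableSet_Ioi,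
    gaussianReal_real_Iio_neg]

theorem measureReal_eq_of_subset_of_subset_of_ae_eq {α : Type*} [MeasurableSpace α]
    {μ : Measure α} [IsFiniteMeasure μ] {s t r : Set α} (hst : s ⊆ t) (htr : t ⊆ r)
    (h : s =ᵐ[μ] r) : μ.real t = μ.real r :=
  le_antisymm (measureReal_mono htr) (measureReal_congr h ▸ measureReal_mono hst)

/-- The probability that a single Gaussian-perturbed coordinate is decoded correctly. -/
theorem gaussianReal_real_clampInt_eq {v : ℝ≥0} {σ : ℝ} (hv : (v : ℝ) = σ ^ 2) (hσ : 0 < σ)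
    {r : ℝ} (hr : 0 < r) {a b x : ℤ}
    (hab : a < b) (hax : a ≤ x) (hxb : x ≤ b) :
    (gaussianReal 0 v).real {t | clampInt a b (x + t / r) = x}
      = if x = a ∨ x = b then 1 / 2 * (1 + phi σ r) else phi σ r := by
  have := nullSingletonClass_gaussianReal (μ := 0) (ne_zero_of_coe_eq_sq hv hσ)
  have hlt {t : ℝ} (ht : t < r / 2) : nround (x + t / r) ≤ x :=
    nround_le_of_lt (by have := (div_lt_iff₀ hr).2 (by linarith : t < 1 / 2 * r); linarith)
  have hgt {t : ℝ} (ht : -(r / 2) < t) : x ≤ nround (x + t / r) :=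
    le_nround_of_lt (by have := (lt_div_iff₀ hr).2 (by linarith : -(1 / 2) * r < t); linarith)
  have hle {t : ℝ} (ht : nround (x + t / r) ≤ x) : t ≤ r / 2 := by
    have := (div_le_iff₀ hr).1 (by linarith [le_of_nround_le ht] : t / r ≤ 1 / 2)
    linarith
  have hge {t : ℝ} (ht : x ≤ nround (x + t / r)) : -(r / 2) ≤ t := by
    have := (le_div_iff₀ hr).1 (by linarith [le_of_le_nround ht] : -(1 / 2) ≤ t / r)
    linarith
  split_ifs with hx
  · rcases hx with rfl | rfl
    · simp_rw [clampInt_eq_left_iff hab]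
      rw [← gaussianReal_real_Iic hv hσ hr]
      exact measureReal_eq_of_subset_of_subset_of_ae_eq (fun t => hlt) (fun t => hle)
        Iio_ae_eq_Iic
    · simp_rw [clampInt_eq_right_iff hab]
      rw [← gaussianReal_real_Ici_neg hv hσ hr]
      exact measureReal_eq_of_subset_of_subset_of_ae_eq (fun t => hgt) (fun t => hge)
        Ioi_ae_eq_Ici
  · push Not at hx
    simp_rw [clampInt_eq_interior_iff (lt_of_le_of_ne hax hx.1.symm) (lt_of_le_of_ne hxb hx.2)]
    rw [← gaussianReal_real_Ioc_neg_self hv hσ hr, measureReal_congr Ioc_ae_eq_Icc]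
    exact measureReal_eq_of_subset_of_subset_of_ae_eq
      (fun t ht => le_antisymm (hlt ht.2) (hgt ht.1)) (fun t ht => ⟨hge ht.ge, hle ht.le⟩)
      Ioo_ae_eq_Icc

/-- Success probability of the box-constrained Babai detector for a deterministic parameter
`x̂ ∈ B` (Theorem 3 of the paper). -/
theorem success_prob_boxBabai_deterministic
    {n : ℕ} (hn : 1 ≤ n)
    (R : Matrix (Fin n) (Fin n) ℝ)
    (hupper : ∀ i j : Fin n, j < i → R i j = 0)
    (hdiag : ∀ i : Fin n, 0 < R i i)
    (σ : ℝ) (hσ : 0 < σ)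
    (l u : Fin n → ℤ) (hlu : ∀ i, l i < u i)
    (xhat : Fin n → ℤ) (hxl : ∀ i, l i ≤ xhat i) (hxu : ∀ i, xhat i ≤ u i)
    {Ω : Type} [MeasurableSpace Ω] (P : Measure Ω) [IsProbabilityMeasure P]
    (v : Ω → Fin n → ℝ) (hmv : Measurable v)
    (hv : Measure.map v P = Measure.pi fun _ : Fin n => gaussianReal 0 ⟨σ ^ 2, sq_nonneg σ⟩) :
    (P {ω | babaiDetector R l u (fun i => (R *ᵥ (fun j => (xhat j : ℝ))) i + v ω i) = xhat}).toReal
      = ∏ i, (if xhat i = l i ∨ xhat i = u i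
              then 1 / 2 * (1 + phi σ (R i i))
              else phi σ (R i i)) := by
  obtain ⟨w, hw, hv'⟩ : ∃ w : ℝ≥0, (w : ℝ) = σ ^ 2 ∧
      Measure.map v P = Measure.pi fun _ : Fin n => gaussianReal 0 w :=
    ⟨⟨σ ^ 2, sq_nonneg σ⟩, rfl, hv⟩
  have hevent : {ω | babaiDetector R l u
      (fun i => (R *ᵥ (fun j => (xhat j : ℝ))) i + v ω i) = xhat}
      = v ⁻¹' Set.univ.pi fun i => {t | clampInt (l i) (u i) (xhat i + t / R i i) = xhat i} := by
    ext ω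
    simp only [Set.mem_ofPred_eq, Set.mem_preimage, Set.mem_univ_pi, babaiDetector_eq_iff]
    refine forall_congr' fun i => ?_
    rw [mulVec_eq_diag_add_of_upper R hupper, add_right_comm, add_sub_cancel_right, add_div,
      mul_div_cancel_left₀ _ (hdiag i).ne']
  have hmeas (i : Fin n) :
      MeasurableSet {t : ℝ | clampInt (l i) (u i) (xhat i + t / R i i) = xhat i} :=
    ((measurable_clampInt (l i) (u i)).comp
      ((measurable_id.div_const _).const_add _)) (measurableSet_singleton (xhat i))
  rw [hevent, ← Measure.map_apply hmv (MeasurableSet.univ_pi hmeas), hv', Measure.pi_pi,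
    ENNReal.toReal_prod]
  exact Finset.prod_congr rfl fun i _ =>
    gaussianReal_real_clampInt_eq hw hσ (hdiag i) (hlu i) (hxl i) (hxu i)
end

section
/- Let n ≥ 1, let R be an n×n real upper triangular matrix with positive diagonal entries r_11,…,r_nn, let σ > 0, and let B = {x ∈ ℤⁿ : ℓ ≤ x ≤ u} with ℓ, u ∈ ℤⁿ and ℓ_i < u_i for all i. For x̄ ∈ B define J(x̄) = det(R)/(2πσ²)^{n/2} · ∫_{I_1(x̄_1)×⋯×I_n(x̄_n)} exp(−‖Rξ‖²/(2σ²)) dξ, where I_i(x̄_i) = (−∞, 1/2] if x̄_i = ℓ_i, I_i(x̄_i) = [−1/2, 1/2] if ℓ_i < x̄_i < u_i, and I_i(x̄_i) = [−1/2, ∞) if x̄_i = u_i. Then ∑_{x̄ ∈ B} J(x̄) ≤ ∏_{i=1}^n [ 1 + (u_i − ℓ_i) · φ_σ(r_ii) ]. -/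
open MeasureTheory ProbabilityTheory Matrix
open scoped ENNReal NNReal

/-- Sequential integration: if `F i` depends only on the coordinates `j ≥ i` and its integral in
the `i`-th coordinate is at most `K i`, then the integral of the product is at most `∏ i, K i`. -/
theorem lintegral_prod_le_prod_of_triangular {n : ℕ} (F : Fin n → (Fin n → ℝ) → ℝ≥0∞)
    (K : Fin n → ℝ≥0∞) (hF : ∀ i, Measurable (F i))
    (hdep : ∀ i ξ η, (∀ j, i ≤ j → ξ j = η j) → F i ξ = F i η)
    (hK : ∀ i ξ, ∫⁻ x, F i (Function.update ξ i x) ≤ K i) :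
    ∫⁻ ξ, ∏ i, F i ξ ≤ ∏ i, K i := by
  induction n with
  | zero => simp [lintegral_unique, volume_pi]
  | succ n ih =>
    have hcons : Measurable fun p : ℝ × (Fin n → ℝ) => (Fin.cons p.1 p.2 : Fin (n + 1) → ℝ) :=
      measurable_pi_iff.2 fun i => by
        refine Fin.cases ?_ (fun j => ?_) i
        · simpa using measurable_fst
        · simp only [Fin.cons_succ]
          exact (measurable_pi_apply j).comp measurable_snd
    have hcons0 : Measurable fun ξ : Fin n → ℝ => (Fin.cons 0 ξ : Fin (n + 1) → ℝ) :=
      hcons.comp (measurable_const.prodMk measurable_id)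
    have hsucc : ∀ (i : Fin n) (x : ℝ) (ξ : Fin n → ℝ),
        F i.succ (Fin.cons x ξ) = F i.succ (Fin.cons 0 ξ) := fun i x ξ =>
      hdep _ _ _ fun j hj => by
        obtain ⟨k, rfl⟩ := Fin.exists_succ_eq.2
          (ne_of_gt (lt_of_lt_of_le (Fin.succ_pos i) hj))
        simp
    have hinner : ∀ ξ : Fin n → ℝ, ∫⁻ x, F 0 (Fin.cons x ξ) ≤ K 0 := fun ξ => by
      simpa using hK 0 (Fin.cons 0 ξ)
    have htail : ∫⁻ ξ : Fin n → ℝ, ∏ i, F (Fin.succ i) (Fin.cons 0 ξ) ≤ ∏ i, K (Fin.succ i) := by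
      refine ih (fun i ξ => F i.succ (Fin.cons 0 ξ)) _ (fun i => (hF _).comp hcons0) ?_ ?_
      · intro i ξ η h
        refine hdep _ _ _ fun j hj => ?_
        induction j using Fin.cases with
        | zero => rfl
        | succ j => simpa using h j (Fin.succ_le_succ_iff.1 hj)
      · intro i ξ
        simpa [Fin.cons_update] using hK i.succ (Fin.cons 0 ξ)
    have hmeas : Measurable fun ξ : Fin (n + 1) → ℝ => ∏ i, F i ξ :=
      Finset.measurable_prod _ fun i _ => hF i
    have hsplit := (volume_preserving_piFinSuccAbove (fun _ : Fin (n + 1) => ℝ) 0).symm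
    calc ∫⁻ ξ, ∏ i, F i ξ
        = ∫⁻ p : ℝ × (Fin n → ℝ), ∏ i, F i (Fin.cons p.1 p.2) := by
          rw [← hsplit.lintegral_comp hmeas]
          simp [MeasurableEquiv.piFinSuccAbove_symm_apply, Fin.insertNthEquiv]
      _ = ∫⁻ ξ : Fin n → ℝ, ∫⁻ x, ∏ i, F i (Fin.cons x ξ) := by
          rw [Measure.volume_eq_prod]
          exact lintegral_prod_symm' _ (hmeas.comp hcons)
      _ = ∫⁻ ξ : Fin n → ℝ,
            (∫⁻ x, F 0 (Fin.cons x ξ)) * ∏ i : Fin n, F i.succ (Fin.cons 0 ξ) := by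
          refine lintegral_congr fun ξ => ?_
          simp_rw [Fin.prod_univ_succ, hsucc]
          exact lintegral_mul_const _
            ((hF 0).comp (hcons.comp (measurable_id.prodMk measurable_const)))
      _ ≤ ∫⁻ ξ : Fin n → ℝ, K 0 * ∏ i : Fin n, F i.succ (Fin.cons 0 ξ) :=
          lintegral_mono fun ξ => mul_le_mul_left (hinner ξ) _
      _ = K 0 * ∫⁻ ξ : Fin n → ℝ, ∏ i : Fin n, F i.succ (Fin.cons 0 ξ) :=
          lintegral_const_mul _ (Finset.measurable_prod _ fun i _ => (hF _).comp hcons0)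
      _ ≤ ∏ i, K i := by
          rw [Fin.prod_univ_succ]
          exact mul_le_mul_right htail _

/-- Among all translates of `[-a, a]`, the centred one has the largest standard Gaussian mass. -/
theorem integral_exp_translate_le (a s : ℝ) (ha : 0 ≤ a) :
    ∫ t in (-a + s)..(a + s), Real.exp (-(t ^ 2) / 2)
      ≤ ∫ t in (-a)..a, Real.exp (-(t ^ 2) / 2) := by
  wlog hs : 0 ≤ s generalizing s
  · refine le_trans (le_of_eq ?_) (this (-s) (by linarith))
    have h := intervalIntegral.integral_comp_neg (a := -a + s) (b := a + s)
      fun t : ℝ => Real.exp (-(t ^ 2) / 2)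
    simp only [neg_sq] at h
    rw [h]
    congr 1 <;> ring
  have hc : Continuous fun t : ℝ => Real.exp (-(t ^ 2) / 2) := by fun_prop
  have hi : ∀ x y, IntervalIntegrable (fun t : ℝ => Real.exp (-(t ^ 2) / 2)) volume x y :=
    fun x y => hc.intervalIntegrable x y
  have h1 := intervalIntegral.integral_add_adjacent_intervals (hi (-a) (-a + s)) (hi (-a + s) a)
  have h2 := intervalIntegral.integral_add_adjacent_intervals (hi (-a + s) a) (hi a (a + s))
  have h3 : ∫ t in a..(a + s), Real.exp (-(t ^ 2) / 2)
      ≤ ∫ t in (-a)..(-a + s), Real.exp (-(t ^ 2) / 2) := by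
    have e1 := intervalIntegral.integral_comp_add_right (a := 0) (b := s)
      (fun t : ℝ => Real.exp (-(t ^ 2) / 2)) a
    have e2 := intervalIntegral.integral_comp_add_right (a := 0) (b := s)
      (fun t : ℝ => Real.exp (-(t ^ 2) / 2)) (-a)
    rw [zero_add, add_comm s] at e1 e2
    rw [← e1, ← e2]
    refine intervalIntegral.integral_mono_on hs
      (Continuous.intervalIntegrable (by fun_prop) _ _)
      (Continuous.intervalIntegrable (by fun_prop) _ _) fun x hx => Real.exp_le_exp.2 ?_
    nlinarith [mul_nonneg ha hx.1]
  linarith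

theorem phi_eq_integral_symm (σ ζ : ℝ) :
    phi σ ζ = 1 / Real.sqrt (2 * Real.pi) *
      ∫ t in (-(ζ / (2 * σ)))..(ζ / (2 * σ)), Real.exp (-(t ^ 2) / 2) := by
  have hi : ∀ x y, IntervalIntegrable (fun t : ℝ => Real.exp (-(t ^ 2) / 2)) volume x y :=
    fun x y => Continuous.intervalIntegrable (by fun_prop) x y
  have h := intervalIntegral.integral_comp_neg (a := 0) (b := ζ / (2 * σ))
    fun t : ℝ => Real.exp (-(t ^ 2) / 2)
  simp only [neg_sq, neg_zero] at h
  rw [← intervalIntegral.integral_add_adjacent_intervals (hi _ 0) (hi 0 _), ← h, phi]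
  ring

theorem phi_nonneg {σ ζ : ℝ} (hσ : 0 < σ) (hζ : 0 ≤ ζ) : 0 ≤ phi σ ζ :=
  mul_nonneg (by positivity) (intervalIntegral.integral_nonneg (by positivity) fun _ _ => by
    positivity)

theorem lintegral_gaussian_affine {r σ : ℝ} (hr : 0 < r) (hσ : 0 < σ) (s : ℝ) :
    ∫⁻ x, ENNReal.ofReal (r / Real.sqrt (2 * Real.pi * σ ^ 2) *
      Real.exp (-((r * x + s) ^ 2) / (2 * σ ^ 2))) = 1 := by
  have hv : ((σ / r) ^ 2).toNNReal ≠ 0 := (Real.toNNReal_pos.2 (by positivity)).ne'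
  rw [← lintegral_gaussianPDFReal_eq_one (-s / r) hv]
  refine lintegral_congr fun x => ?_
  rw [gaussianPDFReal, Real.coe_toNNReal _ (sq_nonneg (σ / r))]
  congr 2
  · rw [show 2 * Real.pi * (σ / r) ^ 2 = 2 * Real.pi * σ ^ 2 / r ^ 2 by ring,
      Real.sqrt_div (by positivity), Real.sqrt_sq hr.le, inv_div]
  · congr 1
    field_simp
    ring

theorem setLIntegral_gaussian_affine_le_phi {r σ : ℝ} (hr : 0 < r) (hσ : 0 < σ) (s : ℝ) :
    ∫⁻ x in Set.Icc (-(1 / 2) : ℝ) (1 / 2), ENNReal.ofReal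
      (r / Real.sqrt (2 * Real.pi * σ ^ 2) * Real.exp (-((r * x + s) ^ 2) / (2 * σ ^ 2)))
      ≤ ENNReal.ofReal (phi σ r) := by
  have hc : Continuous fun x : ℝ =>
      r / Real.sqrt (2 * Real.pi * σ ^ 2) * Real.exp (-((r * x + s) ^ 2) / (2 * σ ^ 2)) := by
    fun_prop
  rw [← ofReal_integral_eq_lintegral_ofReal hc.integrableOn_Icc
    (Filter.Eventually.of_forall fun x => by positivity),
    integral_Icc_eq_integral_Ioc, ← intervalIntegral.integral_of_le (by norm_num)]
  refine ENNReal.ofReal_le_ofReal ?_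
  rw [intervalIntegral.integral_const_mul]
  have hsub := intervalIntegral.integral_comp_mul_add (a := -(1 / 2)) (b := 1 / 2)
    (fun t : ℝ => Real.exp (-(t ^ 2) / 2)) (div_pos hr hσ).ne' (s / σ)
  have hfun : ∀ x : ℝ, -((r / σ * x + s / σ) ^ 2) / 2 = -((r * x + s) ^ 2) / (2 * σ ^ 2) := by
    intro x
    field_simp
  simp only [hfun] at hsub
  rw [hsub, show r / σ * -(1 / 2) + s / σ = -(r / (2 * σ)) + s / σ by ring,
    show r / σ * (1 / 2) + s / σ = r / (2 * σ) + s / σ by ring, phi_eq_integral_symm,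
    Real.sqrt_mul (by positivity), Real.sqrt_sq hσ.le, smul_eq_mul, ← mul_assoc,
    show r / (Real.sqrt (2 * Real.pi) * σ) * (r / σ)⁻¹ = 1 / Real.sqrt (2 * Real.pi) by
      field_simp]
  exact mul_le_mul_of_nonneg_left (integral_exp_translate_le _ _ (by positivity)) (by positivity)

/-- The values of one coordinate of the rounding error for which the box-constrained rounding
detector on `[a, b]` recovers `k`. -/
def roundingCell (a b k : ℤ) : Set ℝ :=
  if k = a then Set.Iic (1 / 2 : ℝ)
  else if k = b then Set.Ici (-(1 / 2) : ℝ)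
  else Set.Icc (-(1 / 2) : ℝ) (1 / 2)

theorem measurableSet_roundingCell (a b k : ℤ) : MeasurableSet (roundingCell a b k) := by
  unfold roundingCell
  split_ifs <;> measurability

theorem sum_indicator_roundingCell_le {a b : ℤ} (hab : a < b) (x : ℝ) :
    ∑ k ∈ Finset.Icc a b, (roundingCell a b k).indicator (1 : ℝ → ℝ≥0∞) x
      ≤ 1 + ENNReal.ofReal ((b - a : ℤ) : ℝ) *
        (Set.Icc (-(1 / 2) : ℝ) (1 / 2)).indicator 1 x := by
  have hIoo : ∑ k ∈ Finset.Ioo a b, (roundingCell a b k).indicator (1 : ℝ → ℝ≥0∞) x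
      = ((b - a - 1).toNat : ℝ≥0∞) * (Set.Icc (-(1 / 2) : ℝ) (1 / 2)).indicator 1 x := by
    rw [← Int.card_Ioo, ← nsmul_eq_mul]
    refine Finset.sum_eq_card_nsmul fun k hk => ?_
    rw [Finset.mem_Ioo] at hk
    rw [roundingCell, if_neg hk.1.ne', if_neg hk.2.ne]
  have hcast : ENNReal.ofReal ((b - a : ℤ) : ℝ) = ((b - a - 1).toNat : ℝ≥0∞) + 1 := by
    have h : ((b - a : ℤ) : ℝ) = (((b - a - 1).toNat + 1 : ℕ) : ℝ) := by
      rw [← Int.cast_natCast]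
      congr 1
      omega
    rw [h, ENNReal.ofReal_natCast]
    push_cast
    rfl
  have hends : (Set.Iic (1 / 2 : ℝ)).indicator (1 : ℝ → ℝ≥0∞) x
      + (Set.Ici (-(1 / 2) : ℝ)).indicator 1 x
      ≤ 1 + (Set.Icc (-(1 / 2) : ℝ) (1 / 2)).indicator 1 x := by
    by_cases h1 : x ≤ 1 / 2 <;> by_cases h2 : -(1 / 2) ≤ x <;>
      simp only [Set.indicator, Set.mem_Iic, Set.mem_Ici, Set.mem_Icc, h1, h2] <;> simp
  rw [← Finset.Ioc_insert_left hab.le, Finset.sum_insert (by simp),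
    ← Finset.Ioo_insert_right hab, Finset.sum_insert (by simp), hIoo, hcast]
  have ha : roundingCell a b a = Set.Iic (1 / 2 : ℝ) := if_pos rfl
  have hb : roundingCell a b b = Set.Ici (-(1 / 2) : ℝ) := by
    rw [roundingCell, if_neg hab.ne', if_pos rfl]
  rw [ha, hb, ← add_assoc, add_mul, one_mul, add_comm (_ * _), ← add_assoc]
  exact add_le_add_left hends _

theorem lintegral_sum_roundingCell_mul_gaussian_le {r σ : ℝ} (hr : 0 < r) (hσ : 0 < σ)
    {a b : ℤ} (hab : a < b) (s : ℝ) :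
    ∫⁻ x, (∑ k ∈ Finset.Icc a b, (roundingCell a b k).indicator (1 : ℝ → ℝ≥0∞) x) *
      ENNReal.ofReal (r / Real.sqrt (2 * Real.pi * σ ^ 2) *
        Real.exp (-((r * x + s) ^ 2) / (2 * σ ^ 2)))
      ≤ ENNReal.ofReal (1 + ((b - a : ℤ) : ℝ) * phi σ r) := by
  set g : ℝ → ℝ≥0∞ := fun x => ENNReal.ofReal (r / Real.sqrt (2 * Real.pi * σ ^ 2) *
        Real.exp (-((r * x + s) ^ 2) / (2 * σ ^ 2))) with hg
  have hgm : Measurable g := by fun_prop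
  have hba : (0 : ℝ) ≤ ((b - a : ℤ) : ℝ) := by exact_mod_cast (sub_pos.2 hab).le
  calc _ ≤ ∫⁻ x, (g x + ENNReal.ofReal ((b - a : ℤ) : ℝ) *
          (Set.Icc (-(1 / 2) : ℝ) (1 / 2)).indicator g x) := by
        refine lintegral_mono fun x => ?_
        refine (mul_le_mul_left (sum_indicator_roundingCell_le hab x) (g x)).trans_eq ?_
        rw [add_mul, one_mul, mul_assoc]
        congr 2
        simp only [Set.indicator]
        split_ifs <;> simp
    _ = 1 + ENNReal.ofReal ((b - a : ℤ) : ℝ) *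
          ∫⁻ x in Set.Icc (-(1 / 2) : ℝ) (1 / 2), g x := by
        rw [lintegral_add_left hgm,
          lintegral_const_mul _ (hgm.indicator measurableSet_Icc),
          lintegral_indicator measurableSet_Icc, lintegral_gaussian_affine hr hσ s]
    _ ≤ 1 + ENNReal.ofReal ((b - a : ℤ) : ℝ) * ENNReal.ofReal (phi σ r) := by
        gcongr
        exact setLIntegral_gaussian_affine_le_phi hr hσ s
    _ = _ := by
        rw [← ENNReal.ofReal_mul hba, ← ENNReal.ofReal_one, ← ENNReal.ofReal_add zero_le_one
          (mul_nonneg hba (phi_nonneg hσ hr.le))]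

theorem det_div_mul_exp_eq_prod {n : ℕ} (R : Matrix (Fin n) (Fin n) ℝ)
    (hupper : ∀ i j : Fin n, j < i → R i j = 0) (σ : ℝ) (ξ : Fin n → ℝ) :
    R.det / (2 * Real.pi * σ ^ 2) ^ ((n : ℝ) / 2) *
        Real.exp (-(∑ j, ((R *ᵥ ξ) j) ^ 2) / (2 * σ ^ 2))
      = ∏ i, (R i i / Real.sqrt (2 * Real.pi * σ ^ 2) *
          Real.exp (-((R *ᵥ ξ) i ^ 2) / (2 * σ ^ 2))) := by
  rw [Finset.prod_mul_distrib, Finset.prod_div_distrib, ← Real.exp_sum,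
    det_of_isUpperTriangular (M := R) fun i j h => hupper i j h]
  congr 2
  · rw [Finset.prod_const, Finset.card_univ, Fintype.card_fin, Real.sqrt_eq_rpow,
      ← Real.rpow_mul_natCast (by positivity)]
    congr 1
    ring
  · rw [← Finset.sum_neg_distrib, Finset.sum_div]

/-- The product of rounding-cell multiplicities and a triangular Gaussian density integrates to at
most the product of the one-dimensional bounds. -/
theorem lintegral_prod_roundingCell_gaussian_le {n : ℕ} (R : Matrix (Fin n) (Fin n) ℝ)
    (hupper : ∀ i j : Fin n, j < i → R i j = 0) (hdiag : ∀ i : Fin n, 0 < R i i)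
    {σ : ℝ} (hσ : 0 < σ) (l u : Fin n → ℤ) (hlu : ∀ i, l i < u i) :
    ∫⁻ ξ : Fin n → ℝ, ∏ i,
      ((∑ k ∈ Finset.Icc (l i) (u i),
          (roundingCell (l i) (u i) k).indicator (1 : ℝ → ℝ≥0∞) (ξ i)) *
        ENNReal.ofReal (R i i / Real.sqrt (2 * Real.pi * σ ^ 2) *
          Real.exp (-((R *ᵥ ξ) i ^ 2) / (2 * σ ^ 2))))
      ≤ ∏ i, ENNReal.ofReal (1 + ((u i - l i : ℤ) : ℝ) * phi σ (R i i)) := by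
  refine lintegral_prod_le_prod_of_triangular (fun i ξ =>
      (∑ k ∈ Finset.Icc (l i) (u i),
          (roundingCell (l i) (u i) k).indicator (1 : ℝ → ℝ≥0∞) (ξ i)) *
        ENNReal.ofReal (R i i / Real.sqrt (2 * Real.pi * σ ^ 2) *
          Real.exp (-((R *ᵥ ξ) i ^ 2) / (2 * σ ^ 2)))) _
    (fun i => ?_) (fun i ξ η h => ?_) fun i ξ => ?_
  · refine Measurable.mul (Finset.measurable_sum _ fun k _ =>
      (measurable_one.indicator (measurableSet_roundingCell _ _ k)).comp
        (measurable_pi_apply i)) ?_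
    simp only [mulVec, dotProduct]
    fun_prop
  · have hR : (R *ᵥ ξ) i = (R *ᵥ η) i := by
      simp only [mulVec, dotProduct]
      refine Finset.sum_congr rfl fun j _ => ?_
      rcases lt_or_ge j i with hj | hj
      · simp [hupper i j hj]
      · rw [h j hj]
    simp only [h i le_rfl, hR]
  · have hR : ∀ x : ℝ, (R *ᵥ Function.update ξ i x) i
        = R i i * x + ∑ j ∈ Finset.univ.erase i, R i j * ξ j := fun x => by
      rw [mulVec, dotProduct, ← Finset.add_sum_erase _ _ (Finset.mem_univ i),
        Function.update_self]
      congr 1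
      refine Finset.sum_congr rfl fun j hj => ?_
      rw [Function.update_of_ne (Finset.ne_of_mem_erase hj)]
    simp only [hR, Function.update_self]
    exact lintegral_sum_roundingCell_mul_gaussian_le (hdiag i) hσ (hlu i) _

/-- Key estimate in the proof of Theorem 5 of the paper: the sum over the box `B` of the
deterministic rounding success probabilities `J(x̄)` is bounded by
`∏ᵢ (1 + (uᵢ - ℓᵢ) φ_σ(rᵢᵢ))`. -/
theorem sum_roundingSuccess_le_prod
    {n : ℕ} (hn : 1 ≤ n)
    (R : Matrix (Fin n) (Fin n) ℝ)
    (hupper : ∀ i j : Fin n, j < i → R i j = 0)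
    (hdiag : ∀ i : Fin n, 0 < R i i)
    (σ : ℝ) (hσ : 0 < σ)
    (l u : Fin n → ℤ) (hlu : ∀ i, l i < u i)
    (B : Finset (Fin n → ℤ)) (hB : B = Fintype.piFinset fun i => Finset.Icc (l i) (u i)) :
    (∑ xb ∈ B,
        R.det / (2 * Real.pi * σ ^ 2) ^ ((n : ℝ) / 2) *
          ∫ ξ in Set.univ.pi (fun i =>
            if xb i = l i then Set.Iic (1 / 2 : ℝ)
            else if xb i = u i then Set.Ici (-(1 / 2) : ℝ)
            else Set.Icc (-(1 / 2) : ℝ) (1 / 2)),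
            Real.exp (-(∑ j, ((R *ᵥ ξ) j) ^ 2) / (2 * σ ^ 2)))
      ≤ ∏ i, (1 + ((u i - l i : ℤ) : ℝ) * phi σ (R i i)) := by
  set G : Fin n → (Fin n → ℝ) → ℝ := fun i ξ => R i i / Real.sqrt (2 * Real.pi * σ ^ 2) *
    Real.exp (-((R *ᵥ ξ) i ^ 2) / (2 * σ ^ 2)) with hG
  have hG0 : ∀ i ξ, 0 ≤ G i ξ := fun i ξ =>
    mul_nonneg (div_nonneg (hdiag i).le (Real.sqrt_nonneg _)) (Real.exp_nonneg _)
  have hGc : ∀ i, Continuous (G i) := fun i => by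
    simp only [hG, mulVec, dotProduct]
    fun_prop
  set P : (Fin n → ℤ) → ℝ≥0∞ := fun xb =>
    ∫⁻ ξ in Set.univ.pi fun i => roundingCell (l i) (u i) (xb i), ∏ i, ENNReal.ofReal (G i ξ)
    with hP
  have hcell : ∀ xb : Fin n → ℤ,
      MeasurableSet (Set.univ.pi fun i => roundingCell (l i) (u i) (xb i)) := fun xb =>
    MeasurableSet.univ_pi fun i => measurableSet_roundingCell _ _ _
  have hGm : ∀ i, Measurable fun ξ => ENNReal.ofReal (G i ξ) := fun i =>
    (hGc i).measurable.ennreal_ofReal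
  have hJ : ∀ xb : Fin n → ℤ,
      R.det / (2 * Real.pi * σ ^ 2) ^ ((n : ℝ) / 2) *
        ∫ ξ in Set.univ.pi (fun i => roundingCell (l i) (u i) (xb i)),
          Real.exp (-(∑ j, ((R *ᵥ ξ) j) ^ 2) / (2 * σ ^ 2)) = (P xb).toReal := fun xb => by
    rw [← integral_const_mul]
    simp_rw [det_div_mul_exp_eq_prod R hupper σ]
    rw [integral_eq_lintegral_of_nonneg_ae
      (Filter.Eventually.of_forall fun ξ => Finset.prod_nonneg fun i _ => hG0 i ξ)
      (continuous_finsetProd _ fun i _ => hGc i).aestronglyMeasurable]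
    simp_rw [hP, ← ENNReal.ofReal_prod_of_nonneg fun i _ => hG0 i _]
  have hsum : ∑ xb ∈ B, P xb
      ≤ ENNReal.ofReal (∏ i, (1 + ((u i - l i : ℤ) : ℝ) * phi σ (R i i))) := by
    rw [ENNReal.ofReal_prod_of_nonneg fun i _ => add_nonneg zero_le_one
      (mul_nonneg (by exact_mod_cast (sub_pos.2 (hlu i)).le) (phi_nonneg hσ (hdiag i).le))]
    refine le_of_eq_of_le ?_ (lintegral_prod_roundingCell_gaussian_le R hupper hdiag hσ l u hlu)
    simp_rw [Finset.prod_mul_distrib, Finset.prod_univ_sum, Finset.sum_mul, ← hB]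
    rw [lintegral_finsetSum]
    · refine Finset.sum_congr rfl fun xb _ => ?_
      simp only [hP]
      rw [← lintegral_indicator (hcell xb)]
      refine lintegral_congr fun ξ => ?_
      by_cases h : ξ ∈ Set.univ.pi fun i => roundingCell (l i) (u i) (xb i)
      · rw [Set.indicator_of_mem h, Finset.prod_eq_one (s := Finset.univ)
          (f := fun i => (roundingCell (l i) (u i) (xb i)).indicator (1 : ℝ → ℝ≥0∞) (ξ i))
          fun i _ => Set.indicator_of_mem (h i trivial) _, one_mul]
      · rw [Set.indicator_of_notMem h]
        simp only [Set.mem_univ_pi, not_forall] at h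
        obtain ⟨i, hi⟩ := h
        rw [Finset.prod_eq_zero (Finset.mem_univ i) (Set.indicator_of_notMem hi _), zero_mul]
    · intro xb _
      exact (Finset.measurable_prod _ fun i _ =>
        (measurable_one.indicator (measurableSet_roundingCell _ _ _)).comp
          (measurable_pi_apply i)).mul (Finset.measurable_prod _ fun i _ => hGm i)
  have hfin : ∀ xb ∈ B, P xb ≠ ⊤ :=
    ENNReal.sum_ne_top.1 (ne_top_of_le_ne_top ENNReal.ofReal_ne_top hsum)
  refine (Finset.sum_congr rfl fun xb _ => hJ xb).trans_le ?_
  rw [← ENNReal.toReal_sum hfin]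
  refine ENNReal.toReal_le_of_le_ofReal (Finset.prod_nonneg fun i _ => add_nonneg zero_le_one
    (mul_nonneg (by exact_mod_cast (sub_pos.2 (hlu i)).le) (phi_nonneg hσ (hdiag i).le))) hsum
end
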